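/- Let w̃ ∈ W̃₁ with image w̄ in W, let ũ ∈ W̃⁺ with ũ ≤ w̃_h w̃, let ṽ ∈ W̃ with ṽ ≤ w₀w̃, and let w ∈ W. If t_{w⁻¹(η)} = ũ⁻¹ṽ, then ũ = w̃_h w̃, ṽ = w₀w̃, and w = w̄. -/

import Mathlib

open scoped Classical Pointwise

namespace SerrePaper

variable (V : Type) [AddCommGroup V] [Module ℝ V]

/-- The combinatorial context of the paper: the character lattice `X` of a split maximal
torus, sitting inside the real vector space `V = X ⊗ ℝ`, together with a reduced
crystallographic root system `R` with positive roots `Rpos`, simple roots `Δ`,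
the coroot pairing `coroot α = ⟨·, α∨⟩`, the weight `η` pairing to `1` with every simple
coroot, and the longest element `w0` of the Weyl group. -/
structure Ctx where
  R : Finset V
  Rpos : Finset V
  Δ : Finset V
  coroot : V → V →ₗ[ℝ] ℝ
  eta : V
  w0 : V ≃ₗ[ℝ] V
  X : AddSubgroup V
  pos_subset : Rpos ⊆ R
  simple_subset : Δ ⊆ Rpos
  root_ne_zero : ∀ α ∈ R, α ≠ (0 : V)
  neg_mem : ∀ α ∈ R, -α ∈ R
  pos_or_neg : ∀ α ∈ R, α ∈ Rpos ∨ -α ∈ Rpos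
  pos_not_neg : ∀ α ∈ Rpos, -α ∉ Rpos
  coroot_self : ∀ α ∈ R, coroot α α = 2
  coroot_neg : ∀ α ∈ R, coroot (-α) = -coroot α
  crystallographic : ∀ α ∈ R, ∀ β ∈ R, ∃ n : ℤ, coroot α β = (n : ℝ)
  reduced : ∀ α ∈ R, ∀ c : ℝ, c • α ∈ R → c = 1 ∨ c = -1
  reflect_root : ∀ α ∈ R, ∀ β ∈ R, β - coroot α β • α ∈ R
  reflect_coroot : ∀ α ∈ R, ∀ β ∈ R, ∀ x : V,
    coroot (β - coroot α β • α) x = coroot β x - coroot β α * coroot α x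
  pos_sum_simple : ∀ α ∈ Rpos, ∃ c : V → ℕ, α = ∑ β ∈ Δ, (c β : ℝ) • β
  simple_indep : LinearIndependent ℝ (fun β : {x // x ∈ Δ} => (β : V))
  eta_pair : ∀ α ∈ Δ, coroot α eta = 1
  root_mem_X : ∀ α ∈ R, α ∈ X
  eta_mem_X : eta ∈ X
  coroot_int : ∀ α ∈ R, ∀ x ∈ X, ∃ n : ℤ, coroot α x = (n : ℝ)
  w0_mem : w0 ∈ Subgroup.closure {g : V ≃ₗ[ℝ] V | ∃ α ∈ R, ∀ x, g x = x - coroot α x • α}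
  w0_neg : ∀ α ∈ Rpos, -(w0 α) ∈ Rpos

namespace Ctx

variable {V}
variable (S : Ctx V)

/-- The (finite) Weyl group, generated by the reflections `s_α`, `α ∈ R`. -/
def Weyl : Subgroup (V ≃ₗ[ℝ] V) :=
  Subgroup.closure {g : V ≃ₗ[ℝ] V | ∃ α ∈ S.R, ∀ x, g x = x - S.coroot α x • α}

/-- The translation `t_ν` as an affine automorphism of `V`. -/
def trans (_S : Ctx V) (ν : V) : V ≃ᵃ[ℝ] V := AffineEquiv.constVAdd ℝ V ν

/-- A linear automorphism viewed as an affine automorphism. -/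
def ofW (_S : Ctx V) (w : V ≃ₗ[ℝ] V) : V ≃ᵃ[ℝ] V := w.toAffineEquiv

/-- The extended affine Weyl group `W̃ = X ⋊ W`, realized as the set of affine
transformations of the form `t_ν ∘ w` with `ν ∈ X` and `w ∈ W`. -/
def extAff : Set (V ≃ᵃ[ℝ] V) :=
  {g | ∃ ν ∈ S.X, ∃ w ∈ S.Weyl, g = S.trans ν * S.ofW w}

/-- The base alcove `A₀`. -/
def A0 : Set V := {x | ∀ α ∈ S.Rpos, 0 < S.coroot α x ∧ S.coroot α x < 1}

/-- The affine hyperplane `⟨·,α∨⟩ = n` separates the base alcove `A₀` from its image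
`g(A₀)`. -/
def Separates (α : V) (n : ℤ) (g : V ≃ᵃ[ℝ] V) : Prop :=
  ((∀ x ∈ S.A0, S.coroot α x < (n : ℝ)) ∧ (∀ x ∈ S.A0, (n : ℝ) < S.coroot α (g x))) ∨
  ((∀ x ∈ S.A0, (n : ℝ) < S.coroot α x) ∧ (∀ x ∈ S.A0, S.coroot α (g x) < (n : ℝ)))

/-- The length `ℓ(g)` of an element of the extended affine Weyl group: the number of
affine root hyperplanes separating `A₀` from `g(A₀)`. -/
noncomputable def len (g : V ≃ᵃ[ℝ] V) : ℕ :=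
  Set.ncard {q : V × ℤ | q.1 ∈ S.Rpos ∧ S.Separates q.1 q.2 g}

/-- The set of affine reflections `s_{α,n} : x ↦ x - (⟨x,α∨⟩ - n)α`. -/
def affRefl : Set (V ≃ᵃ[ℝ] V) :=
  {g | ∃ α ∈ S.R, ∃ n : ℤ, ∀ x, g x = x - (S.coroot α x - (n : ℝ)) • α}

/-- The Bruhat order on the extended affine Weyl group, generated by
`u < r·u` for affine reflections `r` with `ℓ(u) < ℓ(r·u)` (this fixes the
`Ω`-component, so it is the componentwise extension of the Bruhat order on `W_a`). -/
def bruhatLE : (V ≃ᵃ[ℝ] V) → (V ≃ᵃ[ℝ] V) → Prop :=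
  Relation.ReflTransGen fun u w => (∃ r ∈ S.affRefl, w = r * u) ∧ S.len u < S.len w

/-- Jantzen's `↑`-order, transported to the (extended) affine Weyl group via
`w̃ ↦ w̃(A₀)`: generated by `u ↑ s_{α,n}·u` whenever `u(A₀)` lies below the hyperplane
`⟨·,α∨⟩ = n`.  (Under the affine rescaling `λ ↦ (λ+η)/p` this is equivalent to the usual
`↑`-order on `p`-alcoves, transported via the `p`-dot action `w̃ ↦ w̃ · C₀`.) -/
def upLE : (V ≃ᵃ[ℝ] V) → (V ≃ᵃ[ℝ] V) → Prop :=
  Relation.ReflTransGen fun u w =>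
    ∃ α ∈ S.Rpos, ∃ n : ℤ,
      (∀ x : V, w x = u x - (S.coroot α (u x) - (n : ℝ)) • α) ∧
      ∀ x ∈ S.A0, S.coroot α (u x) < (n : ℝ)

/-- `W̃⁺`: the elements of `W̃` taking the base alcove to a dominant alcove. -/
def Wplus : Set (V ≃ᵃ[ℝ] V) :=
  {g | g ∈ S.extAff ∧ ∀ x ∈ S.A0, ∀ α ∈ S.Δ, 0 < S.coroot α (g x)}

/-- `W̃₁`: the elements of `W̃` taking the base alcove to a restricted alcove. -/
def Wone : Set (V ≃ᵃ[ℝ] V) :=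
  {g | g ∈ S.extAff ∧ ∀ x ∈ S.A0, ∀ α ∈ S.Δ,
    0 < S.coroot α (g x) ∧ S.coroot α (g x) < 1}

/-- `w̃_h = w₀ t_{-η}`. -/
noncomputable def wh : V ≃ᵃ[ℝ] V := S.ofW S.w0 * S.trans (-S.eta)

/-- The lowest `p`-alcove `C₀`. -/
def C0 (p : ℕ) : Set V :=
  {x | ∀ α ∈ S.Rpos, 0 < S.coroot α (x + S.eta) ∧ S.coroot α (x + S.eta) < (p : ℝ)}

/-- The root lattice `ℤR`. -/
def rootLattice : AddSubgroup V := AddSubgroup.closure (S.R : Set V)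

/-- `Ω`: the stabilizer of the base alcove in `W̃`. -/
def Omega : Set (V ≃ᵃ[ℝ] V) := {g | g ∈ S.extAff ∧ g '' S.A0 = S.A0}

/-- The `λ`-admissible set `Adm(λ) = ⋃_{w ∈ W} W̃_{≤ t_{w(λ)}}`. -/
def Adm (lam : V) : Set (V ≃ᵃ[ℝ] V) :=
  {g | ∃ w ∈ S.Weyl, S.bruhatLE g (S.trans (w lam))}

/-- `α∨` is a highest coroot, i.e. the highest root of an irreducible component of the
dual root system `R∨`: equivalently, `α∨` is a dominant coroot and no simple coroot can
be added to `α∨` to yield a coroot. -/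
def IsHighestCoroot (α : V) : Prop :=
  α ∈ S.R ∧ (∀ β ∈ S.Δ, 0 ≤ S.coroot α β) ∧
    ∀ β ∈ S.Δ, ∀ γ ∈ S.R, S.coroot γ ≠ S.coroot α + S.coroot β

end Ctx


namespace Ctx

variable {V : Type} [AddCommGroup V] [Module ℝ V] (S : Ctx V)

section RootSystem

/-- The reflection `s_α` attached to a root `α`. -/
noncomputable def refl (α : {x // x ∈ S.R}) : V ≃ₗ[ℝ] V :=
  Module.reflection (S.coroot_self α α.2)

lemma refl_apply (α : {x // x ∈ S.R}) (x : V) :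
    S.refl α x = x - S.coroot α x • (α : V) := by
  simp [refl, Module.reflection_apply]

lemma refl_refl (α : {x // x ∈ S.R}) (x : V) : S.refl α (S.refl α x) = x :=
  Module.involutive_reflection (S.coroot_self α α.2) x

lemma refl_mul_self (α : {x // x ∈ S.R}) : S.refl α * S.refl α = 1 := by
  ext x; exact S.refl_refl α x

lemma refl_self (α : {x // x ∈ S.R}) : S.refl α (α : V) = -(α : V) := by
  rw [refl_apply, S.coroot_self α α.2, two_smul]; abel

lemma eq_refl {g : V ≃ₗ[ℝ] V} {α : V} (hα : α ∈ S.R)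
    (h : ∀ x, g x = x - S.coroot α x • α) : g = S.refl ⟨α, hα⟩ := by
  ext x; rw [h, refl_apply]

lemma refl_mem_Weyl (α : {x // x ∈ S.R}) : S.refl α ∈ S.Weyl :=
  Subgroup.subset_closure ⟨α, α.2, S.refl_apply α⟩

lemma pos_mem {α : V} (h : α ∈ S.Rpos) : α ∈ S.R := S.pos_subset h

lemma simple_mem {α : V} (h : α ∈ S.Δ) : α ∈ S.R := S.pos_subset (S.simple_subset h)

/-- The Weyl group permutes the roots and the coroots compatibly. -/
lemma Weyl_root {w : V ≃ₗ[ℝ] V} (hw : w ∈ S.Weyl) :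
    (∀ α, w α ∈ S.R ↔ α ∈ S.R) ∧
      ∀ α ∈ S.R, ∀ x, S.coroot (w α) (w x) = S.coroot α x := by
  induction hw using Subgroup.closure_induction with
  | mem g hg =>
    obtain ⟨α, hα, hg⟩ := hg
    obtain rfl := S.eq_refl hα hg
    have key : ∀ β ∈ S.R, S.refl ⟨α, hα⟩ β ∈ S.R := fun β hβ => by
      rw [hg]; exact S.reflect_root α hα β hβ
    refine ⟨fun β => ⟨fun h => ?_, key β⟩, fun β hβ x => ?_⟩
    · simpa only [S.refl_refl] using key _ h
    · rw [hg β, S.reflect_coroot α hα β hβ, hg x]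
      simp only [map_sub, map_smul, smul_eq_mul, S.coroot_self α hα]
      ring
  | one => simp
  | mul a b _ _ ha hb =>
    refine ⟨fun α => (ha.1 (b α)).trans (hb.1 α), fun α hα x => ?_⟩
    exact (ha.2 (b α) ((hb.1 α).2 hα) (b x)).trans (hb.2 α hα x)
  | inv a _ ha =>
    have e : ∀ y, a (a⁻¹ y) = y := fun y => a.apply_symm_apply y
    have h1 : ∀ α, a⁻¹ α ∈ S.R ↔ α ∈ S.R := fun α => by rw [← ha.1, e]
    refine ⟨h1, fun α hα x => ?_⟩
    rw [← ha.2 _ ((h1 α).2 hα), e, e]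

lemma Weyl_mem {w : V ≃ₗ[ℝ] V} (hw : w ∈ S.Weyl) {α : V} (hα : α ∈ S.R) : w α ∈ S.R :=
  ((S.Weyl_root hw).1 α).2 hα

lemma coroot_Weyl {w : V ≃ₗ[ℝ] V} (hw : w ∈ S.Weyl) {α : V} (hα : α ∈ S.R) (x : V) :
    S.coroot α (w x) = S.coroot (w⁻¹ α) x := by
  have e : w (w⁻¹ α) = α := w.apply_symm_apply α
  rw [← (S.Weyl_root hw).2 _ (S.Weyl_mem (inv_mem hw) hα), e]

lemma Weyl_X {w : V ≃ₗ[ℝ] V} (hw : w ∈ S.Weyl) : ∀ x, w x ∈ S.X ↔ x ∈ S.X := by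
  induction hw using Subgroup.closure_induction with
  | mem g hg =>
    obtain ⟨α, hα, hg⟩ := hg
    obtain rfl := S.eq_refl hα hg
    have key : ∀ x ∈ S.X, S.refl ⟨α, hα⟩ x ∈ S.X := fun x hx => by
      obtain ⟨n, hn⟩ := S.coroot_int α hα x hx
      rw [hg, hn, Int.cast_smul_eq_zsmul]
      exact sub_mem hx (zsmul_mem (S.root_mem_X α hα) n)
    exact fun x => ⟨fun h => by simpa only [S.refl_refl] using key _ h, key x⟩
  | one => simp
  | mul a b _ _ ha hb => exact fun x => (ha (b x)).trans (hb x)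
  | inv a _ ha =>
    intro x
    have e : a (a⁻¹ x) = x := a.apply_symm_apply x
    rw [← ha, e]

lemma sum_Weyl {w : V ≃ₗ[ℝ] V} (hw : w ∈ S.Weyl) (f : V → ℤ)
    (hf : ∀ α ∈ S.R, f (-α) = f α) :
    ∑ α ∈ S.Rpos, f (w α) = ∑ α ∈ S.Rpos, f α := by
  have two : ∀ f : V → ℤ, (∀ α ∈ S.R, f (-α) = f α) →
      ∑ α ∈ S.R, f α = 2 * ∑ α ∈ S.Rpos, f α := by
    intro f hf
    have hR : S.R = S.Rpos ∪ S.Rpos.image Neg.neg := by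
      ext α
      simp only [Finset.mem_union, Finset.mem_image]
      constructor
      · intro h
        rcases S.pos_or_neg α h with h | h
        · exact Or.inl h
        · exact Or.inr ⟨-α, h, neg_neg α⟩
      · rintro (h | ⟨β, h, rfl⟩)
        · exact S.pos_mem h
        · exact S.neg_mem _ (S.pos_mem h)
    have hd : Disjoint S.Rpos (S.Rpos.image Neg.neg) := by
      rw [Finset.disjoint_left]
      intro α h h'
      obtain ⟨β, hβ, rfl⟩ := Finset.mem_image.1 h'
      exact S.pos_not_neg β hβ h
    rw [hR, Finset.sum_union hd, Finset.sum_image (fun a _ b _ h => neg_injective h),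
      Finset.sum_congr rfl (fun α hα => hf α (S.pos_mem hα)), two_mul]
  have h1 := two f hf
  have h2 := two (fun α => f (w α)) fun α hα => by
    simpa using hf (w α) (S.Weyl_mem hw hα)
  have h3 : ∑ α ∈ S.R, f (w α) = ∑ α ∈ S.R, f α :=
    Finset.sum_equiv w.toEquiv (fun α => ((S.Weyl_root hw).1 α).symm) (fun _ _ => rfl)
  linarith

/-- The canonical Weyl-invariant symmetric form. -/
noncomputable def form (x : V) : V →ₗ[ℝ] ℝ := ∑ γ ∈ S.R, S.coroot γ x • S.coroot γ

lemma form_apply (x y : V) : S.form x y = ∑ γ ∈ S.R, S.coroot γ x * S.coroot γ y := by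
  simp [form]

lemma form_comm (x y : V) : S.form x y = S.form y x := by
  simp only [form_apply, mul_comm]

lemma form_Weyl {w : V ≃ₗ[ℝ] V} (hw : w ∈ S.Weyl) (x y : V) :
    S.form (w x) (w y) = S.form x y := by
  rw [form_apply, form_apply]
  symm
  refine Finset.sum_equiv w.toEquiv (fun α => ((S.Weyl_root hw).1 α).symm) fun α hα => ?_
  change _ = S.coroot (w α) (w x) * S.coroot (w α) (w y)
  rw [(S.Weyl_root hw).2 α hα, (S.Weyl_root hw).2 α hα]

lemma form_self_pos {α : V} (hα : α ∈ S.R) : 0 < S.form α α := by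
  rw [form_apply]
  refine Finset.sum_pos' (fun _ _ => mul_self_nonneg _) ⟨α, hα, ?_⟩
  rw [S.coroot_self α hα]; norm_num

lemma coroot_mul_form {α : V} (hα : α ∈ S.R) (x : V) :
    S.coroot α x * S.form α α = 2 * S.form α x := by
  have h := S.form_Weyl (S.refl_mem_Weyl ⟨α, hα⟩) α x
  have h0 : S.form (-α) = - S.form α := by ext y; simp [form_apply]
  rw [S.refl_self ⟨α, hα⟩, S.refl_apply, h0] at h
  simp only [LinearMap.neg_apply, map_sub, map_smul, smul_eq_mul] at h
  linarith

/-- A vector strictly dominant for the simple roots is strictly dominant for all positive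
roots. -/
lemma coroot_pos {x : V} (hx : ∀ β ∈ S.Δ, 0 < S.coroot β x) {α : V} (hα : α ∈ S.Rpos) :
    0 < S.coroot α x := by
  have hR := S.pos_mem hα
  obtain ⟨c, hc⟩ := S.pos_sum_simple α hα
  have hβ : ∀ β ∈ S.Δ, 0 < S.form x β := fun β hβ => by
    have h1 := S.coroot_mul_form (S.simple_mem hβ) x
    have h2 := mul_pos (hx β hβ) (S.form_self_pos (S.simple_mem hβ))
    rw [form_comm]; linarith
  have h0 : 0 < S.form x α := by
    have hsum : S.form x α = ∑ β ∈ S.Δ, (c β : ℝ) * S.form x β := by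
      conv_lhs => rw [hc]
      simp
    rw [hsum]
    refine Finset.sum_pos' (fun β h => mul_nonneg (Nat.cast_nonneg _) (hβ β h).le) ?_
    by_contra! hcon
    apply S.root_ne_zero α hR
    rw [hc]
    refine Finset.sum_eq_zero fun β h => ?_
    have : (c β : ℝ) = 0 := by
      by_contra hne
      exact absurd (mul_pos (lt_of_le_of_ne (Nat.cast_nonneg _) (Ne.symm hne)) (hβ β h))
        (not_lt.2 (hcon β h))
    rw [this, zero_smul]
  have h1 := S.coroot_mul_form hR x
  rw [S.form_comm α x] at h1
  by_contra! hcon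
  have := mul_nonpos_of_nonpos_of_nonneg hcon (S.form_self_pos hR).le
  linarith

lemma eta_pos {α : V} (hα : α ∈ S.Rpos) : 0 < S.coroot α S.eta :=
  S.coroot_pos (fun β hβ => by rw [S.eta_pair β hβ]; exact one_pos) hα

lemma exists_functional (g : V → ℝ) : ∃ f : V →ₗ[ℝ] ℝ, ∀ β ∈ S.Δ, f β = g β := by
  obtain ⟨f, hf⟩ := LinearMap.exists_extend
    ((Module.Basis.span S.simple_indep).constr ℝ (fun β => g β))
  refine ⟨f, fun β hβ => ?_⟩
  have h := LinearMap.congr_fun hf (Module.Basis.span S.simple_indep ⟨β, hβ⟩)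
  rw [Module.Basis.constr_basis] at h
  simpa [Module.Basis.span_apply] using h

/-- A simple reflection permutes the positive roots other than its own root. -/
lemma refl_pos {β : V} (hβ : β ∈ S.Δ) {α : V} (hα : α ∈ S.Rpos) (hne : α ≠ β) :
    S.refl ⟨β, S.simple_mem hβ⟩ α ∈ S.Rpos := by
  have hmem := S.Weyl_mem (S.refl_mem_Weyl ⟨β, S.simple_mem hβ⟩) (S.pos_mem hα)
  refine (S.pos_or_neg _ hmem).resolve_right fun hneg => ?_
  obtain ⟨c, hc⟩ := S.pos_sum_simple α hα
  obtain ⟨d, hd⟩ := S.pos_sum_simple _ hneg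
  have hzero : ∀ γ ∈ S.Δ, γ ≠ β → c γ = 0 := by
    intro γ hγ hγβ
    obtain ⟨f, hf⟩ := S.exists_functional (fun x => if x = γ then 1 else 0)
    have hval : ∀ e : V → ℕ, f (∑ β ∈ S.Δ, (e β : ℝ) • β) = e γ := fun e => by
      rw [map_sum, Finset.sum_eq_single γ]
      · rw [map_smul, hf γ hγ]; simp
      · intro b hb hbγ
        rw [map_smul, hf b hb]; simp [hbγ]
      · exact fun h => absurd hγ h
    have h1 : f α = c γ := by rw [← hval c, ← hc]
    have h2 := congrArg f hd
    rw [hval d, S.refl_apply, map_neg, map_sub, map_smul, hf β hβ, h1,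
      if_neg (Ne.symm hγβ)] at h2
    simp only [smul_zero, sub_zero] at h2
    have h3 : (0 : ℝ) ≤ c γ := Nat.cast_nonneg _
    have h4 : (0 : ℝ) ≤ d γ := Nat.cast_nonneg _
    have : (c γ : ℝ) = 0 := by linarith
    exact_mod_cast this
  have hαβ : α = (c β : ℝ) • β := by
    conv_lhs => rw [hc]
    refine Finset.sum_eq_single β (fun γ hγ hγβ => ?_) (fun h => absurd hβ h)
    rw [hzero γ hγ hγβ]; simp
  rcases S.reduced β (S.simple_mem hβ) (c β) (hαβ ▸ S.pos_mem hα) with h | h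
  · rw [h, one_smul] at hαβ; exact hne hαβ
  · have : (0 : ℝ) ≤ c β := Nat.cast_nonneg _
    linarith

lemma conj_refl {w : V ≃ₗ[ℝ] V} (hw : w ∈ S.Weyl) (α : {x // x ∈ S.R}) :
    w * S.refl α = S.refl ⟨w α, S.Weyl_mem hw α.2⟩ * w := by
  ext x
  change w (S.refl α x) = S.refl ⟨w α, _⟩ (w x)
  rw [refl_apply, refl_apply, (S.Weyl_root hw).2 α α.2, map_sub, map_smul]

/-- The element `w` is a product of `k` simple reflections. -/
def IsWord (k : ℕ) (w : V ≃ₗ[ℝ] V) : Prop :=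
  ∃ l : List {x // x ∈ S.Δ}, l.length = k ∧
    (l.map fun β : {x // x ∈ S.Δ} => S.refl ⟨β, S.simple_mem β.2⟩).prod = w

lemma exists_isWord_mul {v w : V ≃ₗ[ℝ] V} (hv : ∃ k, S.IsWord k v) (hw : ∃ k, S.IsWord k w) :
    ∃ k, S.IsWord k (v * w) := by
  obtain ⟨_, l, -, rfl⟩ := hv
  obtain ⟨_, m, -, rfl⟩ := hw
  exact ⟨_, l ++ m, rfl, by simp⟩

lemma isWord_inv {k : ℕ} {w : V ≃ₗ[ℝ] V} (h : S.IsWord k w) : S.IsWord k w⁻¹ := by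
  obtain ⟨l, hl, rfl⟩ := h
  refine ⟨l.reverse, by simpa using hl, ?_⟩
  rw [List.prod_inv_reverse, List.map_reverse, List.map_map]
  refine congrArg (fun m => (List.reverse m).prod) (List.map_congr_left fun β _ => ?_)
  exact eq_inv_of_mul_eq_one_left (S.refl_mul_self _)

lemma isWord_zero {w : V ≃ₗ[ℝ] V} (h : S.IsWord 0 w) : w = 1 := by
  obtain ⟨l, hl, rfl⟩ := h
  simp [List.length_eq_zero_iff.1 hl]

lemma isWord_succ {k : ℕ} {w : V ≃ₗ[ℝ] V} :
    S.IsWord (k + 1) w ↔ ∃ γ, ∃ hγ : γ ∈ S.Δ, ∃ v,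
      S.IsWord k v ∧ w = S.refl ⟨γ, S.simple_mem hγ⟩ * v := by
  constructor
  · rintro ⟨l, hl, rfl⟩
    obtain ⟨γ, l, rfl⟩ := List.exists_cons_of_length_eq_add_one hl
    exact ⟨γ, γ.2, _, ⟨l, by simpa using hl, rfl⟩, by simp⟩
  · rintro ⟨γ, hγ, v, ⟨l, hl, rfl⟩, rfl⟩
    exact ⟨⟨γ, hγ⟩ :: l, by simpa using hl, by simp⟩

lemma isWord_mem {k : ℕ} {w : V ≃ₗ[ℝ] V} (h : S.IsWord k w) : w ∈ S.Weyl := by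
  obtain ⟨l, -, rfl⟩ := h
  refine list_prod_mem fun x hx => ?_
  obtain ⟨β, -, rfl⟩ := List.mem_map.1 hx
  exact S.refl_mem_Weyl _

lemma exists_isWord_refl (n : ℕ) : ∀ α, ∀ h : α ∈ S.Rpos, ∀ c : V → ℕ,
    α = ∑ β ∈ S.Δ, (c β : ℝ) • β → ∑ β ∈ S.Δ, c β < n →
      ∃ k, S.IsWord k (S.refl ⟨α, S.pos_mem h⟩) := by
  obtain ⟨ht, hht⟩ := S.exists_functional (fun _ => 1)
  have hval : ∀ e : V → ℕ, ht (∑ β ∈ S.Δ, (e β : ℝ) • β) = (∑ β ∈ S.Δ, e β : ℕ) := fun e => by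
    rw [map_sum, Nat.cast_sum]
    exact Finset.sum_congr rfl fun β hβ => by rw [map_smul, hht β hβ]; simp
  induction n with
  | zero => intro _ _ _ _ h; omega
  | succ n ih =>
    intro α hα c hc hn
    have hR := S.pos_mem hα
    obtain ⟨β, hβ, hpos⟩ : ∃ β ∈ S.Δ, 0 < S.form α β := by
      by_contra! hcon
      have h1 : S.form α α = ∑ β ∈ S.Δ, (c β : ℝ) * S.form α β := by
        conv_lhs => arg 2; rw [hc]
        simp
      have h2 := S.form_self_pos hR
      rw [h1] at h2
      exact absurd h2 (not_lt.2 (Finset.sum_nonpos fun β hβ =>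
        mul_nonpos_of_nonneg_of_nonpos (Nat.cast_nonneg _) (hcon β hβ)))
    have hβR := S.simple_mem hβ
    have hword : ∃ k, S.IsWord k (S.refl ⟨β, hβR⟩) := ⟨1, [⟨β, hβ⟩], rfl, by simp⟩
    by_cases hαβ : α = β
    · subst hαβ; exact hword
    have hpos' : 0 < S.coroot β α := by
      have h1 := S.coroot_mul_form hβR α
      rw [S.form_comm β α] at h1
      by_contra! hcon
      have := mul_nonpos_of_nonpos_of_nonneg hcon (S.form_self_pos hβR).le
      linarith
    obtain ⟨m, hm⟩ := S.crystallographic β hβR α hR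
    have hm1 : (1 : ℝ) ≤ S.coroot β α := by
      rw [hm] at hpos' ⊢
      have : 0 < m := by exact_mod_cast hpos'
      exact_mod_cast Int.add_one_le_iff.2 this
    have hα' := S.refl_pos hβ hα hαβ
    obtain ⟨d, hd⟩ := S.pos_sum_simple _ hα'
    have hlt : ∑ β ∈ S.Δ, d β < n := by
      have h1 := congrArg ht hd
      have h2 := congrArg ht hc
      rw [hval, S.refl_apply, map_sub, map_smul, hht β hβ, smul_eq_mul, mul_one] at h1
      rw [hval] at h2
      have h3 : ((∑ β ∈ S.Δ, d β : ℕ) : ℝ) + 1 ≤ (∑ β ∈ S.Δ, c β : ℕ) := by linarith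
      have : (∑ β ∈ S.Δ, d β) + 1 ≤ ∑ β ∈ S.Δ, c β := by exact_mod_cast h3
      omega
    have hconj := S.conj_refl (S.refl_mem_Weyl ⟨β, hβR⟩) ⟨_, S.pos_mem hα'⟩
    simp only [S.refl_refl] at hconj
    have : S.refl ⟨α, hR⟩ =
        S.refl ⟨β, hβR⟩ * (S.refl ⟨_, S.pos_mem hα'⟩ * S.refl ⟨β, hβR⟩) := by
      rw [← mul_assoc, hconj, mul_assoc, refl_mul_self, mul_one]
    rw [this]
    exact S.exists_isWord_mul hword (S.exists_isWord_mul (ih _ hα' d hd hlt) hword)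

/-- The Weyl group is generated by the simple reflections. -/
lemma exists_isWord {w : V ≃ₗ[ℝ] V} (hw : w ∈ S.Weyl) : ∃ k, S.IsWord k w := by
  induction hw using Subgroup.closure_induction with
  | mem g hg =>
    obtain ⟨α, hα, hg⟩ := hg
    rcases S.pos_or_neg α hα with h | h
    · obtain rfl := S.eq_refl hα hg
      obtain ⟨c, hc⟩ := S.pos_sum_simple _ h
      exact S.exists_isWord_refl _ _ h c hc (Nat.lt_succ_self _)
    · obtain ⟨c, hc⟩ := S.pos_sum_simple _ h
      rw [S.eq_refl (g := g) (S.pos_mem h) fun x => by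
        rw [hg, S.coroot_neg α hα]; simp]
      exact S.exists_isWord_refl _ _ h c hc (Nat.lt_succ_self _)
  | one => exact ⟨0, [], rfl, rfl⟩
  | mul a b _ _ ha hb => exact S.exists_isWord_mul ha hb
  | inv a _ ha => exact ha.imp fun k h => S.isWord_inv h

/-- The exchange property. -/
lemma exchange {β : V} (hβ : β ∈ S.Δ) (k : ℕ) : ∀ w, S.IsWord k w → w β ∉ S.Rpos →
    ∃ j, j + 1 = k ∧ S.IsWord j (w * S.refl ⟨β, S.simple_mem hβ⟩) := by
  induction k with
  | zero =>
    intro w hw hneg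
    rw [S.isWord_zero hw] at hneg
    exact absurd (S.simple_subset hβ) hneg
  | succ k ih =>
    intro w hw hneg
    obtain ⟨γ, hγ, v, hv, rfl⟩ := S.isWord_succ.1 hw
    refine ⟨k, rfl, ?_⟩
    by_cases h : v β ∈ S.Rpos
    · have hvβ : v β = γ := by
        by_contra hne
        exact hneg (S.refl_pos hγ h hne)
      have hconj := S.conj_refl (S.isWord_mem hv) ⟨β, S.simple_mem hβ⟩
      simp only [hvβ] at hconj
      rw [mul_assoc, hconj, ← mul_assoc, refl_mul_self, one_mul]
      exact hv
    · obtain ⟨j, rfl, hj⟩ := ih v hv h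
      rw [mul_assoc]
      exact S.isWord_succ.2 ⟨γ, hγ, _, hj, rfl⟩

lemma isWord_eq_one (k : ℕ) : ∀ z, S.IsWord k z → (∀ α, z α ∈ S.Rpos ↔ α ∈ S.Rpos) →
    z = 1 := by
  induction k using Nat.strong_induction_on with
  | _ k ih =>
    intro z hz hpos
    cases k with
    | zero => exact S.isWord_zero hz
    | succ k =>
      obtain ⟨γ, hγ, v, hv, rfl⟩ := S.isWord_succ.1 hz
      set s := S.refl ⟨γ, S.simple_mem hγ⟩ with hs
      have hss : s * s = 1 := S.refl_mul_self _
      have hinv : v⁻¹ * s = (s * v)⁻¹ := by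
        rw [mul_inv_rev, ← eq_inv_of_mul_eq_one_left hss]
      have hposinv : ∀ α, (s * v)⁻¹ α ∈ S.Rpos ↔ α ∈ S.Rpos := fun α => by
        rw [← hpos]
        have : (s * v) ((s * v)⁻¹ α) = α := (s * v).apply_symm_apply α
        rw [this]
      have hneg : v⁻¹ γ ∉ S.Rpos := by
        have h1 : v⁻¹ γ = -((s * v)⁻¹ γ) := by
          rw [← hinv]
          change _ = -(v⁻¹ (s γ))
          rw [hs, S.refl_self ⟨γ, S.simple_mem hγ⟩, map_neg, neg_neg]
        rw [h1]
        exact fun h => S.pos_not_neg _ ((hposinv γ).2 (S.simple_subset hγ)) h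
      obtain ⟨j, hj, hw⟩ := S.exchange hγ k _ (S.isWord_inv hv) hneg
      rw [← hs, hinv] at hw
      exact inv_eq_one.1 (ih j (by omega) _ hw hposinv)

/-- The stabilizer of `η` in the Weyl group is trivial. -/
lemma eq_one_of_eta {z : V ≃ₗ[ℝ] V} (hz : z ∈ S.Weyl) (h : z S.eta = S.eta) : z = 1 := by
  have key : ∀ α ∈ S.R, α ∈ S.Rpos ↔ 0 < S.coroot α S.eta := fun α hα => by
    refine ⟨S.eta_pos, fun h0 => (S.pos_or_neg α hα).resolve_right fun hn => ?_⟩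
    have := S.eta_pos hn
    rw [S.coroot_neg α hα, LinearMap.neg_apply] at this
    linarith
  obtain ⟨k, hk⟩ := S.exists_isWord hz
  refine S.isWord_eq_one k z hk fun α => ?_
  have hroot := S.Weyl_root hz
  by_cases hα : α ∈ S.R
  · rw [key _ ((hroot.1 α).2 hα), key _ hα, ← hroot.2 α hα S.eta, h]
  · exact ⟨fun h' => absurd ((hroot.1 α).1 (S.pos_mem h')) hα,
      fun h' => absurd (S.pos_mem h') hα⟩

end RootSystem

section Length

lemma exists_mem_A0 : ∃ x, x ∈ S.A0 := by
  set M := 1 + ∑ α ∈ S.Rpos, S.coroot α S.eta with hM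
  have hnn : ∀ α ∈ S.Rpos, 0 ≤ S.coroot α S.eta := fun α hα => (S.eta_pos hα).le
  have hMpos : 0 < M := by have := Finset.sum_nonneg hnn; linarith
  refine ⟨M⁻¹ • S.eta, fun α hα => ?_⟩
  rw [map_smul, smul_eq_mul]
  refine ⟨mul_pos (inv_pos.2 hMpos) (S.eta_pos hα), ?_⟩
  rw [inv_mul_lt_iff₀ hMpos, mul_one]
  have := Finset.single_le_sum hnn hα
  linarith

lemma trans_mul_ofW_apply (ν : V) (w : V ≃ₗ[ℝ] V) (x : V) :
    (S.trans ν * S.ofW w) x = ν + w x := rfl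

lemma extAff_mul {g h : V ≃ᵃ[ℝ] V} (hg : g ∈ S.extAff) (hh : h ∈ S.extAff) :
    g * h ∈ S.extAff := by
  obtain ⟨ν, hν, w, hw, rfl⟩ := hg
  obtain ⟨μ, hμ, v, hv, rfl⟩ := hh
  refine ⟨ν + w μ, add_mem hν ((S.Weyl_X hw μ).2 hμ), w * v, mul_mem hw hv, ?_⟩
  ext x
  change ν + w (μ + v x) = ν + w μ + w (v x)
  rw [map_add, add_assoc]

lemma ofW_mem_extAff {w : V ≃ₗ[ℝ] V} (hw : w ∈ S.Weyl) : S.ofW w ∈ S.extAff :=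
  ⟨0, zero_mem _, w, hw, by ext x; exact (zero_add (w x)).symm⟩

lemma trans_mem_extAff {ν : V} (hν : ν ∈ S.X) : S.trans ν ∈ S.extAff :=
  ⟨ν, hν, 1, one_mem _, rfl⟩

/-- An element of the extended affine Weyl group maps `A₀` strictly between two consecutive
hyperplanes of each parallel class. -/
lemma exists_strip {g : V ≃ᵃ[ℝ] V} (hg : g ∈ S.extAff) {α : V} (hα : α ∈ S.R) :
    ∃ k : ℤ, ∀ x ∈ S.A0, (k : ℝ) < S.coroot α (g x) ∧ S.coroot α (g x) < k + 1 := by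
  obtain ⟨ν, hν, w, hw, rfl⟩ := hg
  obtain ⟨n, hn⟩ := S.coroot_int α hα ν hν
  have hβ := S.Weyl_mem (inv_mem hw) hα
  have e : ∀ x, S.coroot α ((S.trans ν * S.ofW w) x) = n + S.coroot (w⁻¹ α) x := fun x => by
    rw [trans_mul_ofW_apply, map_add, hn, S.coroot_Weyl hw hα]
  rcases S.pos_or_neg _ hβ with h | h
  · refine ⟨n, fun x hx => ?_⟩
    have := hx _ h
    rw [e]
    constructor <;> linarith
  · refine ⟨n - 1, fun x hx => ?_⟩
    have := hx _ h
    rw [S.coroot_neg _ hβ, LinearMap.neg_apply] at this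
    rw [e]
    push_cast
    constructor <;> linarith

lemma floor_of_strip {k : ℤ} {b : ℝ} (h : (k : ℝ) < b ∧ b < k + 1) : ⌊b⌋ = k :=
  Int.floor_eq_iff.2 ⟨h.1.le, h.2⟩

/-- The length is computed by counting hyperplanes in each parallel class. -/
lemma len_eq {g : V ≃ᵃ[ℝ] V} (hg : g ∈ S.extAff) {x₀ : V} (hx₀ : x₀ ∈ S.A0) :
    (S.len g : ℤ) = ∑ α ∈ S.Rpos, |⌊S.coroot α (g x₀)⌋| := by
  set I : V → Finset ℤ := fun α =>
    Finset.Ioc 0 ⌊S.coroot α (g x₀)⌋ ∪ Finset.Ioc ⌊S.coroot α (g x₀)⌋ 0 with hI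
  have hset : {q : V × ℤ | q.1 ∈ S.Rpos ∧ S.Separates q.1 q.2 g} =
      ((S.Rpos.sigma I).map (Equiv.sigmaEquivProd V ℤ).toEmbedding : Finset (V × ℤ)) := by
    ext ⟨α, n⟩
    simp only [Set.mem_ofPred_eq, Finset.coe_map, Set.mem_image, Finset.mem_coe,
      Finset.mem_sigma, Sigma.exists, Equiv.coe_toEmbedding, Equiv.sigmaEquivProd_apply,
      Prod.mk.injEq]
    have : (∃ a b, (a ∈ S.Rpos ∧ b ∈ I a) ∧ a = α ∧ b = n) ↔ α ∈ S.Rpos ∧ n ∈ I α :=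
      ⟨by rintro ⟨_, _, h, rfl, rfl⟩; exact h, fun h => ⟨_, _, h, rfl, rfl⟩⟩
    rw [this]
    refine and_congr_right fun hα => ?_
    obtain ⟨k, hk⟩ := S.exists_strip hg (S.pos_mem hα)
    simp only [hI, floor_of_strip (hk x₀ hx₀), Finset.mem_union, Finset.mem_Ioc]
    constructor
    · rintro (⟨h1, h2⟩ | ⟨h1, h2⟩)
      · left
        have a1 := h1 x₀ hx₀
        have a2 := h2 x₀ hx₀
        have a3 := hk x₀ hx₀
        have a4 := hx₀ α hα
        have b1 : (0 : ℝ) < n := by linarith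
        have b2 : (n : ℝ) < k + 1 := by linarith
        exact ⟨by exact_mod_cast b1, Int.lt_add_one_iff.1 (by exact_mod_cast b2)⟩
      · right
        have a1 := h1 x₀ hx₀
        have a2 := h2 x₀ hx₀
        have a3 := hk x₀ hx₀
        have a4 := hx₀ α hα
        have b1 : (n : ℝ) < 0 + 1 := by linarith
        have b2 : (k : ℝ) < n := by linarith
        exact ⟨by exact_mod_cast b2, Int.lt_add_one_iff.1 (by exact_mod_cast b1)⟩
    · rintro (⟨h1, h2⟩ | ⟨h1, h2⟩)
      · left
        have b1 : (1 : ℝ) ≤ n := by exact_mod_cast h1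
        have b2 : (n : ℝ) ≤ k := by exact_mod_cast h2
        exact ⟨fun x hx => by have := hx α hα; linarith,
          fun x hx => by have := hk x hx; linarith⟩
      · right
        have b1 : (k : ℝ) + 1 ≤ n := by exact_mod_cast h1
        have b2 : (n : ℝ) ≤ 0 := by exact_mod_cast h2
        exact ⟨fun x hx => by have := hx α hα; linarith,
          fun x hx => by have := hk x hx; linarith⟩
  rw [len, hset, Set.ncard_coe_finset, Finset.card_map, Finset.card_sigma, Nat.cast_sum]
  refine Finset.sum_congr rfl fun α _ => ?_
  rw [hI, Finset.card_union_of_disjoint, Int.card_Ioc, Int.card_Ioc]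
  · rcases abs_cases ⌊S.coroot α (g x₀)⌋ with h | h <;> omega
  · rw [Finset.disjoint_left]
    intro n h1 h2
    rw [Finset.mem_Ioc] at h1 h2
    omega

lemma floor_coroot_neg {g : V ≃ᵃ[ℝ] V} (hg : g ∈ S.extAff) {x₀ : V} (hx₀ : x₀ ∈ S.A0)
    {α : V} (hα : α ∈ S.R) :
    ⌊-S.coroot α (g x₀)⌋ = -⌊S.coroot α (g x₀)⌋ - 1 := by
  obtain ⟨k, hk⟩ := S.exists_strip hg hα
  have h := hk x₀ hx₀
  rw [floor_of_strip h]
  apply floor_of_strip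
  push_cast
  constructor <;> linarith

lemma one_mem_extAff : (1 : V ≃ᵃ[ℝ] V) ∈ S.extAff :=
  S.ofW_mem_extAff (one_mem S.Weyl)

/-- Subadditivity of the length. -/
lemma len_le {u t : V ≃ᵃ[ℝ] V} (hu : u ∈ S.extAff) (ht : t ∈ S.extAff) :
    S.len t ≤ S.len u + S.len (u * t) := by
  obtain ⟨x₀, hx₀⟩ := S.exists_mem_A0
  zify
  rw [S.len_eq ht hx₀, S.len_eq hu hx₀, S.len_eq (S.extAff_mul hu ht) hx₀]
  have hsum : ∑ α ∈ S.Rpos, |⌊S.coroot α (t x₀)⌋| =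
      ∑ α ∈ S.Rpos, |⌊S.coroot α ((u * t) x₀)⌋ - ⌊S.coroot α (u x₀)⌋| := by
    obtain ⟨ν, hν, w, hw, rfl⟩ := hu
    have h := S.sum_Weyl (inv_mem hw) (fun α => |⌊S.coroot α (t x₀)⌋ - ⌊S.coroot α x₀⌋|)
      fun α hα => by
        have h1 := S.floor_coroot_neg ht hx₀ hα
        have h2 : ⌊-S.coroot α x₀⌋ = -⌊S.coroot α x₀⌋ - 1 :=
          S.floor_coroot_neg S.one_mem_extAff hx₀ hα
        simp only [S.coroot_neg α hα, LinearMap.neg_apply]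
        rw [h1, h2, ← abs_neg]
        congr 1
        ring
    calc _ = ∑ α ∈ S.Rpos, |⌊S.coroot α (t x₀)⌋ - ⌊S.coroot α x₀⌋| := by
          refine Finset.sum_congr rfl fun α hα => ?_
          have h0 : ⌊S.coroot α x₀⌋ = 0 := floor_of_strip (by
            have := hx₀ α hα
            push_cast
            constructor <;> linarith)
          rw [h0, sub_zero]
      _ = _ := h.symm
      _ = _ := by
          refine Finset.sum_congr rfl fun α hα => ?_
          obtain ⟨n, hn⟩ := S.coroot_int α (S.pos_mem hα) ν hν
          have e : ∀ y, ⌊S.coroot α ((S.trans ν * S.ofW w) y)⌋ =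
              n + ⌊S.coroot (w⁻¹ α) y⌋ := fun y => by
            rw [trans_mul_ofW_apply, map_add, hn, S.coroot_Weyl hw (S.pos_mem hα),
              Int.floor_intCast_add]
          change _ = |⌊S.coroot α ((S.trans ν * S.ofW w) (t x₀))⌋ - _|
          rw [e, e, add_sub_add_left_eq_sub]
  rw [hsum, ← Finset.sum_add_distrib]
  refine Finset.sum_le_sum fun α _ => ?_
  rw [add_comm]
  exact abs_sub _ _

lemma len_trans_eta {w : V ≃ₗ[ℝ] V} (hw : w ∈ S.Weyl) :
    (S.len (S.trans (w S.eta)) : ℤ) = ∑ α ∈ S.Rpos, ⌊S.coroot α S.eta⌋ := by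
  obtain ⟨x₀, hx₀⟩ := S.exists_mem_A0
  have hint : ∀ α ∈ S.R, ∀ y ∈ S.X, S.coroot α y = ⌊S.coroot α y⌋ := fun α hα y hy => by
    obtain ⟨n, hn⟩ := S.coroot_int α hα y hy
    rw [hn, Int.floor_intCast]
  have hwη := (S.Weyl_X hw _).2 S.eta_mem_X
  rw [S.len_eq (S.trans_mem_extAff hwη) hx₀]
  have h := S.sum_Weyl (inv_mem hw) (fun α => |⌊S.coroot α S.eta⌋|) fun α hα => by
    obtain ⟨n, hn⟩ := S.coroot_int α hα _ S.eta_mem_X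
    simp only [S.coroot_neg α hα, LinearMap.neg_apply]
    rw [hn, ← Int.cast_neg, Int.floor_intCast, Int.floor_intCast, abs_neg]
  calc _ = ∑ α ∈ S.Rpos, |⌊S.coroot (w⁻¹ α) S.eta⌋| := by
        refine Finset.sum_congr rfl fun α hα => ?_
        have e : S.coroot α (S.trans (w S.eta) x₀) =
            S.coroot α (w S.eta) + S.coroot α x₀ := map_add _ _ _
        have h0 : ⌊S.coroot α x₀⌋ = 0 := floor_of_strip (by
          have := hx₀ α hα
          push_cast
          constructor <;> linarith)
        rw [e, hint α (S.pos_mem hα) _ hwη, Int.floor_intCast_add, h0, add_zero,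
          S.coroot_Weyl hw (S.pos_mem hα)]
    _ = _ := h
    _ = _ := Finset.sum_congr rfl fun α hα =>
        abs_of_nonneg (Int.floor_nonneg.2 (S.eta_pos hα).le)

lemma sum_neg_w0 (f : V → ℤ) : ∑ α ∈ S.Rpos, f (-(S.w0⁻¹ α)) = ∑ α ∈ S.Rpos, f α := by
  have hinj : Set.InjOn (fun α => -(S.w0 α)) S.Rpos := fun a _ b _ h =>
    S.w0.injective (neg_injective h)
  have himg : S.Rpos.image (fun α => -(S.w0 α)) = S.Rpos :=
    Finset.eq_of_subset_of_card_le
      (Finset.image_subset_iff.2 fun α hα => S.w0_neg α hα)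
      (by rw [Finset.card_image_of_injOn hinj])
  conv_lhs => rw [← himg]
  rw [Finset.sum_image hinj]
  refine Finset.sum_congr rfl fun α _ => ?_
  have : S.w0⁻¹ (S.w0 α) = α := S.w0.symm_apply_apply α
  rw [map_neg, this, neg_neg]

lemma w0_mem_Weyl : S.w0 ∈ S.Weyl := S.w0_mem

lemma coroot_w0 {α : V} (hα : α ∈ S.R) (x : V) :
    S.coroot α (S.w0 x) = -S.coroot (-(S.w0⁻¹ α)) x := by
  rw [S.coroot_neg _ (S.Weyl_mem (inv_mem S.w0_mem_Weyl) hα), LinearMap.neg_apply, neg_neg,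
    S.coroot_Weyl S.w0_mem_Weyl hα]

lemma neg_w0_mem {α : V} (hα : α ∈ S.R) : -(S.w0⁻¹ α) ∈ S.R :=
  S.neg_mem _ (S.Weyl_mem (inv_mem S.w0_mem_Weyl) hα)

lemma wh_mem_extAff : S.wh ∈ S.extAff :=
  S.extAff_mul (S.ofW_mem_extAff S.w0_mem_Weyl) (S.trans_mem_extAff (S.X.neg_mem S.eta_mem_X))

/-- The lengths of `w̃_h w̃` and `w₀ w̃` add up to that of `t_η`, for restricted `w̃`. -/
lemma len_wh_add_len_w0 {g : V ≃ᵃ[ℝ] V} (hg : g ∈ S.Wone) :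
    (S.len (S.wh * g) : ℤ) + S.len (S.ofW S.w0 * g) = ∑ α ∈ S.Rpos, ⌊S.coroot α S.eta⌋ := by
  obtain ⟨hgX, hres⟩ := hg
  obtain ⟨x₀, hx₀⟩ := S.exists_mem_A0
  have hdom : ∀ α ∈ S.Rpos, 0 < S.coroot α (g x₀) := fun α hα =>
    S.coroot_pos (fun β hβ => (hres x₀ hx₀ β hβ).1) hα
  have hdom' : ∀ α ∈ S.Rpos, 0 < S.coroot α (S.eta - g x₀) := fun α hα =>
    S.coroot_pos (fun β hβ => by
      rw [map_sub, S.eta_pair β hβ]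
      linarith [(hres x₀ hx₀ β hβ).2]) hα
  have h1 : (S.len (S.ofW S.w0 * g) : ℤ) = ∑ α ∈ S.Rpos, (⌊S.coroot α (g x₀)⌋ + 1) := by
    rw [S.len_eq (S.extAff_mul (S.ofW_mem_extAff S.w0_mem_Weyl) hgX) hx₀]
    calc _ = ∑ α ∈ S.Rpos, |⌊S.coroot (-(S.w0⁻¹ α)) (g x₀)⌋ + 1| := by
          refine Finset.sum_congr rfl fun α hα => ?_
          change |⌊S.coroot α (S.w0 (g x₀))⌋| = _
          rw [S.coroot_w0 (S.pos_mem hα),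
            S.floor_coroot_neg hgX hx₀ (S.neg_w0_mem (S.pos_mem hα)), ← abs_neg]
          congr 1
          ring
      _ = _ := S.sum_neg_w0 (fun α => |⌊S.coroot α (g x₀)⌋ + 1|)
      _ = _ := Finset.sum_congr rfl fun α hα => abs_of_nonneg (by
          have := Int.floor_nonneg.2 (hdom α hα).le
          omega)
  have hsplit : ∀ α ∈ S.R, ⌊S.coroot α (S.eta - g x₀)⌋ =
      ⌊S.coroot α S.eta⌋ - (⌊S.coroot α (g x₀)⌋ + 1) := fun α hα => by
    obtain ⟨n, hn⟩ := S.coroot_int α hα _ S.eta_mem_X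
    rw [map_sub, sub_eq_add_neg, hn, Int.floor_intCast_add, S.floor_coroot_neg hgX hx₀ hα,
      Int.floor_intCast]
    ring
  have h2 : (S.len (S.wh * g) : ℤ) =
      ∑ α ∈ S.Rpos, (⌊S.coroot α S.eta⌋ - (⌊S.coroot α (g x₀)⌋ + 1)) := by
    rw [S.len_eq (S.extAff_mul S.wh_mem_extAff hgX) hx₀]
    calc _ = ∑ α ∈ S.Rpos, |⌊S.coroot (-(S.w0⁻¹ α)) (S.eta - g x₀)⌋| := by
          refine Finset.sum_congr rfl fun α hα => ?_
          change |⌊S.coroot α (S.w0 (-S.eta + g x₀))⌋| = _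
          rw [S.coroot_w0 (S.pos_mem hα), ← map_neg]
          congr 4
          abel
      _ = _ := S.sum_neg_w0 (fun α => |⌊S.coroot α (S.eta - g x₀)⌋|)
      _ = _ := Finset.sum_congr rfl fun α hα => by
          rw [abs_of_nonneg (Int.floor_nonneg.2 (hdom' α hα).le), hsplit α (S.pos_mem hα)]
  rw [h1, h2, ← Finset.sum_add_distrib]
  exact Finset.sum_congr rfl fun α _ => by ring

lemma bruhatLE_eq_or_len_lt {u w : V ≃ᵃ[ℝ] V} (h : S.bruhatLE u w) :
    u = w ∨ S.len u < S.len w := by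
  induction h with
  | refl => exact Or.inl rfl
  | tail _ h ih =>
    right
    rcases ih with rfl | ih
    · exact h.2
    · exact ih.trans h.2

end Length

lemma wh_mul_trans {ν : V} {w : V ≃ₗ[ℝ] V} :
    S.wh * (S.trans ν * S.ofW w) * S.trans (w⁻¹ S.eta) =
      S.ofW S.w0 * (S.trans ν * S.ofW w) := by
  ext x
  change S.w0 (-S.eta + (ν + w (w⁻¹ S.eta + x))) = S.w0 (ν + w x)
  have : w (w⁻¹ S.eta) = S.eta := w.apply_symm_apply _
  rw [map_add w, this]
  congr 1
  abel

end Ctx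

/-- if `w̃ ∈ W̃₁` has image `w̄` in `W`, `ũ ∈ W̃⁺` with `ũ ≤ w̃_h w̃`,
`ṽ ≤ w₀w̃`, `w ∈ W`, and `t_{w⁻¹(η)} = ũ⁻¹ṽ`, then `ũ = w̃_h w̃`, `ṽ = w₀w̃` and
`w = w̄`. -/
theorem statement18 {V : Type} [AddCommGroup V] [Module ℝ V] [FiniteDimensional ℝ V]
    (S : Ctx V)
    (ν : V) (hν : ν ∈ S.X)
    (wbar : V ≃ₗ[ℝ] V) (hwbar : wbar ∈ S.Weyl)
    (wt : V ≃ᵃ[ℝ] V) (hwtdef : wt = S.trans ν * S.ofW wbar) (hwt : wt ∈ S.Wone)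
    (u : V ≃ᵃ[ℝ] V) (hu : u ∈ S.Wplus) (huB : S.bruhatLE u (S.wh * wt))
    (v : V ≃ᵃ[ℝ] V) (hv : v ∈ S.extAff) (hvB : S.bruhatLE v (S.ofW S.w0 * wt))
    (w : V ≃ₗ[ℝ] V) (hw : w ∈ S.Weyl)
    (ht : S.trans (w⁻¹ S.eta) = u⁻¹ * v) :
    u = S.wh * wt ∧ v = S.ofW S.w0 * wt ∧ w = wbar := by
  have hmul : u * S.trans (w⁻¹ S.eta) = v := by rw [ht, mul_inv_cancel_left]
  have hw' := inv_mem hw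
  have htX := S.trans_mem_extAff ((S.Weyl_X hw' _).2 S.eta_mem_X)
  have hle := S.len_le hu.1 htX
  rw [hmul] at hle
  have hlen := (S.len_trans_eta hw').trans (S.len_wh_add_len_w0 hwt).symm
  have hlen' : S.len (S.trans (w⁻¹ S.eta)) =
      S.len (S.wh * wt) + S.len (S.ofW S.w0 * wt) := by exact_mod_cast hlen
  have hueq : u = S.wh * wt := by
    rcases S.bruhatLE_eq_or_len_lt huB with h | h
    · exact h
    · rcases S.bruhatLE_eq_or_len_lt hvB with rfl | h' <;> omega
  have hveq : v = S.ofW S.w0 * wt := by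
    rcases S.bruhatLE_eq_or_len_lt hvB with h | h
    · exact h
    · rw [hueq] at hle; omega
  refine ⟨hueq, hveq, ?_⟩
  have hη : S.trans (w⁻¹ S.eta) = S.trans (wbar⁻¹ S.eta) := by
    apply mul_left_cancel (a := S.wh * wt)
    rw [← hueq, hmul, hveq, hueq, hwtdef, S.wh_mul_trans]
  have hη' : w⁻¹ S.eta = wbar⁻¹ S.eta := by
    have h := congrArg (fun g : V ≃ᵃ[ℝ] V => g 0) hη
    simpa [Ctx.trans] using h
  have hz : (wbar * w⁻¹) S.eta = S.eta := by
    change wbar (w⁻¹ S.eta) = S.eta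
    rw [hη']
    exact wbar.apply_symm_apply _
  exact (mul_inv_eq_one.1 (S.eq_one_of_eta (mul_mem hwbar hw') hz)).symm

end SerrePaper
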